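/- arXiv:2001.04038 — 3 statements merged into one kernel-verified Lean document; each statement's English description precedes it below -/
import Mathlib

section
/- Let (E, 𝓛, 𝓑) be a weakly left-resolving labeled space and let {p_A : A ∈ 𝓑}, {s_a : a ∈ 𝒜} be a representation of (E, 𝓛, 𝓑) in a C*-algebra B. Then the C*-subalgebra of B generated by {p_A : A ∈ 𝓑} ∪ {s_a : a ∈ 𝒜} equals the closed linear span of the set {s_μ p_A s_ν* : μ, ν ∈ 𝓛^#(E), A ∈ 𝓑}, where for μ = ε or ν = ε the corresponding factor s_μ or s_ν* is omitted. -/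
universe u v w

/-- A labeled graph: a directed graph with source and range maps together with a
labeling of the edges by an alphabet `Λ` (onto, i.e. `Λ = 𝓛(E¹)`). -/
structure LabeledGraph (V : Type u) (E : Type v) (Λ : Type w) where
  src : E → V
  rng : E → V
  lab : E → Λ
  lab_surj : Function.Surjective lab

namespace LabeledGraph

variable {V : Type u} {E : Type v} {Λ : Type w} (G : LabeledGraph V E Λ)

/-- A (finite, nonempty) path: a nonempty list of composable edges. -/
def IsPath (p : List E) : Prop :=
  p ≠ [] ∧ p.Chain' (fun e f => G.rng e = G.src f)

/-- The relative range `r(A, α)`. -/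
def relRange (A : Set V) (α : List Λ) : Set V :=
  {v | ∃ p : List E, G.IsPath p ∧ p.map G.lab = α ∧
      (∃ e, p.head? = some e ∧ G.src e ∈ A) ∧
      (∃ e, p.getLast? = some e ∧ G.rng e = v)}

/-- The range `r(α) = r(E⁰, α)`. -/
def range (α : List Λ) : Set V := G.relRange Set.univ α

/-- The source set `s(α)` of a word. -/
def srcSet (α : List Λ) : Set V :=
  {v | ∃ p : List E, G.IsPath p ∧ p.map G.lab = α ∧
      (∃ e, p.head? = some e ∧ G.src e = v)}

/-- `𝓛(A E¹)`: the labels of edges with source in `A`. -/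
def labelSet (A : Set V) : Set Λ :=
  {a | ∃ e, G.src e ∈ A ∧ G.lab e = a}

/-- `𝓛*(E)`: the labels of finite nonempty paths. -/
def words : Set (List Λ) :=
  {α | ∃ p : List E, G.IsPath p ∧ p.map G.lab = α}

/-- `𝓛^#(E) = 𝓛*(E) ∪ {ε}`. -/
def wordsHash : Set (List Λ) := insert [] G.words

/-- The set of sinks `E⁰_sink`. -/
def sinks : Set V := {v | ∀ e : E, G.src e ≠ v}

/-- `ℬ ⊆ 2^{E⁰}` is accommodating. -/
structure Accommodating (ℬ : Set (Set V)) : Prop where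
  nonempty : ∃ A ∈ ℬ, A ≠ ∅
  range_mem : ∀ α ∈ G.words, G.range α ∈ ℬ
  relRange_mem : ∀ A ∈ ℬ, ∀ α ∈ G.words, G.relRange A α ∈ ℬ
  inter_mem : ∀ A ∈ ℬ, ∀ B ∈ ℬ, A ∩ B ∈ ℬ
  union_mem : ∀ A ∈ ℬ, ∀ B ∈ ℬ, A ∪ B ∈ ℬ

/-- `(E, 𝓛, ℬ)` is weakly left-resolving. -/
def WeaklyLeftResolving (ℬ : Set (Set V)) : Prop :=
  ∀ A ∈ ℬ, ∀ B ∈ ℬ, ∀ α ∈ G.words,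
    G.relRange (A ∩ B) α = G.relRange A α ∩ G.relRange B α

/-- `ℬ` is closed under relative complements (non-degeneracy). -/
def NonDegenerate (_G : LabeledGraph V E Λ) (ℬ : Set (Set V)) : Prop :=
  ∀ A ∈ ℬ, ∀ B ∈ ℬ, A \ B ∈ ℬ

/-- A hereditary subset `ℋ` of `ℬ` (not containing `∅`). -/
structure Hereditary (ℬ ℋ : Set (Set V)) : Prop where
  subset : ℋ ⊆ ℬ
  empty_not_mem : ∅ ∉ ℋ
  relRange_mem : ∀ A ∈ ℋ, ∀ α ∈ G.words, G.relRange A α ≠ ∅ → G.relRange A α ∈ ℋ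
  union_mem : ∀ A ∈ ℋ, ∀ B ∈ ℋ, A ∪ B ∈ ℋ
  mem_of_subset : ∀ A ∈ ℋ, ∀ B ∈ ℬ, B ≠ ∅ → B ⊆ A → B ∈ ℋ

/-- A minimal sinks set. -/
def MinimalSinksSet (ℬ : Set (Set V)) (A : Set V) : Prop :=
  A ∈ ℬ ∧ A.Nonempty ∧ A ⊆ G.sinks ∧ ∀ B ∈ ℬ, A ⊆ B ∨ A ∩ B = ∅

end LabeledGraph

/-- A representation of the labeled space `(E, 𝓛, ℬ)` in a C*-algebra `B`. -/
structure LabeledSpaceRep {V : Type u} {E : Type v} {Λ : Type w}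
    (G : LabeledGraph V E Λ) (ℬ : Set (Set V))
    (B : Type*) [CStarAlgebra B] where
  p : Set V → B
  s : Λ → B
  p_empty : p ∅ = 0
  p_selfAdjoint : ∀ A ∈ ℬ, star (p A) = p A
  s_partialIsometry : ∀ a : Λ, s a * star (s a) * s a = s a
  p_inter : ∀ A ∈ ℬ, ∀ A' ∈ ℬ, p A * p A' = p (A ∩ A')
  p_union : ∀ A ∈ ℬ, ∀ A' ∈ ℬ, p (A ∪ A') = p A + p A' - p (A ∩ A')
  s_star_s : ∀ a b : Λ, star (s a) * s b = open Classical in if a = b then p (G.range [a]) else 0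

  s_star_p : ∀ a : Λ, ∀ A ∈ ℬ, star (s a) * p A = p (G.relRange A [a]) * star (s a)
  p_sum : ∀ A ∈ ℬ, ∀ hfin : (G.labelSet A).Finite, A ∩ G.sinks = ∅ →
      p A = ∑ a ∈ hfin.toFinset, s a * p (G.relRange A [a]) * star (s a)

namespace LabeledSpaceRep

variable {V : Type u} {E : Type v} {Λ : Type w}
  {G : LabeledGraph V E Λ} {ℬ : Set (Set V)}
  {B : Type*} [CStarAlgebra B]

/-- `s_μ = s_{a₁} ⋯ s_{aₙ}` for a word `μ = a₁ ⋯ aₙ`; `s_ε = 1`. -/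
def sWord (ρ : LabeledSpaceRep G ℬ B) (μ : List Λ) : B := (μ.map ρ.s).prod

end LabeledSpaceRep

namespace LabeledGraph

variable {V : Type u} {E : Type v} {Λ : Type w} (G : LabeledGraph V E Λ)

theorem singleton_mem_words (a : Λ) : [a] ∈ G.words := by
  obtain ⟨e, rfl⟩ := G.lab_surj a
  exact ⟨[e], ⟨by simp, List.isChain_singleton e⟩, rfl⟩

/-- The relative range of a word computed one letter at a time. -/
def iterRange (A : Set V) : List Λ → Set V
  | [] => A
  | a :: α => iterRange (G.relRange A [a]) α

variable {G}

theorem Accommodating.iterRange_mem {ℬ : Set (Set V)} (hacc : G.Accommodating ℬ)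
    {A : Set V} (hA : A ∈ ℬ) (α : List Λ) : G.iterRange A α ∈ ℬ := by
  induction α generalizing A with
  | nil => exact hA
  | cons a α ih => exact ih (hacc.relRange_mem A hA [a] (G.singleton_mem_words a))

theorem exists_edge_of_mem_relRange_singleton {A : Set V} {a : Λ} {v : V}
    (hv : v ∈ G.relRange A [a]) : ∃ e, G.src e ∈ A ∧ G.lab e = a ∧ G.rng e = v := by
  obtain ⟨p, -, hlab, ⟨e, he, hs⟩, ⟨f, hf, hr⟩⟩ := hv
  obtain ⟨g, rfl, hg⟩ := List.map_eq_singleton_iff.mp hlab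
  simp only [List.head?_cons, List.getLast?_singleton, Option.some.injEq] at he hf
  subst he hf
  exact ⟨g, hs, hg, hr⟩

theorem exists_path_of_iterRange_nonempty {A : Set V} {a : Λ} {α : List Λ}
    (h : (G.iterRange A (a :: α)).Nonempty) :
    ∃ e p, G.IsPath (e :: p) ∧ (e :: p).map G.lab = a :: α ∧ G.src e ∈ A := by
  induction α generalizing A a with
  | nil =>
    obtain ⟨v, hv⟩ := h
    obtain ⟨e, hs, hl, -⟩ := exists_edge_of_mem_relRange_singleton hv
    exact ⟨e, [], ⟨by simp, List.isChain_singleton e⟩, by simp [hl], hs⟩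
  | cons b α ih =>
    obtain ⟨f, p, hp, hl, hs⟩ := ih (A := G.relRange A [a]) h
    obtain ⟨e, hs', hl', hr⟩ := exists_edge_of_mem_relRange_singleton hs
    exact ⟨e, f :: p, ⟨by simp, List.isChain_cons_cons.mpr ⟨hr, hp.2⟩⟩,
      by rw [List.map_cons, hl, hl'], hs'⟩

end LabeledGraph

namespace LabeledSpaceRep

variable {V : Type u} {E : Type v} {Λ : Type w}
  {G : LabeledGraph V E Λ} {ℬ : Set (Set V)}
  {B : Type*} [CStarAlgebra B]

@[simp] theorem sWord_nil (ρ : LabeledSpaceRep G ℬ B) : ρ.sWord [] = 1 := rfl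

theorem sWord_cons (ρ : LabeledSpaceRep G ℬ B) (a : Λ) (μ : List Λ) :
    ρ.sWord (a :: μ) = ρ.s a * ρ.sWord μ := by simp [sWord]

theorem sWord_concat (ρ : LabeledSpaceRep G ℬ B) (μ : List Λ) (a : Λ) :
    ρ.sWord (μ ++ [a]) = ρ.sWord μ * ρ.s a := by simp [sWord]

theorem s_mul_p_range (ρ : LabeledSpaceRep G ℬ B) (a : Λ) :
    ρ.s a * ρ.p (G.range [a]) = ρ.s a := by
  have h := ρ.s_star_s a a
  rw [if_pos rfl] at h
  rw [← h, ← mul_assoc, ρ.s_partialIsometry]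

theorem p_mul_s (ρ : LabeledSpaceRep G ℬ B) (hacc : G.Accommodating ℬ)
    {A : Set V} (hA : A ∈ ℬ) (a : Λ) :
    ρ.p A * ρ.s a = ρ.s a * ρ.p (G.relRange A [a]) := by
  have h := congrArg star (ρ.s_star_p a A hA)
  rwa [star_mul, star_mul, star_star, ρ.p_selfAdjoint A hA, ρ.p_selfAdjoint _
    (hacc.relRange_mem A hA [a] (G.singleton_mem_words a))] at h

theorem p_mul_sWord (ρ : LabeledSpaceRep G ℬ B) (hacc : G.Accommodating ℬ)
    {A : Set V} (hA : A ∈ ℬ) (μ : List Λ) :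
    ρ.p A * ρ.sWord μ = ρ.sWord μ * ρ.p (G.iterRange A μ) := by
  induction μ generalizing A with
  | nil => simp [LabeledGraph.iterRange]
  | cons a μ ih =>
    rw [sWord_cons, ← mul_assoc, ρ.p_mul_s hacc hA, mul_assoc,
      ih (hacc.relRange_mem A hA [a] (G.singleton_mem_words a)), ← mul_assoc]
    rfl

theorem sWord_eq_zero (ρ : LabeledSpaceRep G ℬ B) (hacc : G.Accommodating ℬ)
    {μ : List Λ} (hμ : μ ∉ G.wordsHash) : ρ.sWord μ = 0 := by
  cases μ with
  | nil => exact absurd (Set.mem_insert _ _) hμ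
  | cons a μ =>
    have hempty : G.iterRange (G.range [a]) μ = ∅ := by
      by_contra hne
      obtain ⟨e, p, hp, hl, -⟩ := LabeledGraph.exists_path_of_iterRange_nonempty
        (A := Set.univ) (Set.nonempty_iff_ne_empty.mpr hne)
      exact hμ (Set.mem_insert_of_mem _ ⟨e :: p, hp, hl⟩)
    rw [sWord_cons, ← ρ.s_mul_p_range a, mul_assoc,
      ρ.p_mul_sWord hacc (hacc.range_mem [a] (G.singleton_mem_words a)), hempty, ρ.p_empty,
      mul_zero, mul_zero]

/-- The linear span of the elements `s_μ p_A s_ν*` with `μ, ν` arbitrary lists of letters. -/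
noncomputable def monomialSpan (ρ : LabeledSpaceRep G ℬ B) : Submodule ℂ B :=
  Submodule.span ℂ {x : B | ∃ μ ν : List Λ, ∃ A ∈ ℬ,
    x = ρ.sWord μ * ρ.p A * star (ρ.sWord ν)}

theorem monomial_mem (ρ : LabeledSpaceRep G ℬ B) (μ ν : List Λ) {A : Set V} (hA : A ∈ ℬ) :
    ρ.sWord μ * ρ.p A * star (ρ.sWord ν) ∈ ρ.monomialSpan :=
  Submodule.subset_span ⟨μ, ν, A, hA, rfl⟩

theorem span_words_eq_monomialSpan (ρ : LabeledSpaceRep G ℬ B) (hacc : G.Accommodating ℬ) :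
    Submodule.span ℂ {x : B | ∃ μ ∈ G.wordsHash, ∃ ν ∈ G.wordsHash, ∃ A ∈ ℬ,
      x = ρ.sWord μ * ρ.p A * star (ρ.sWord ν)} = ρ.monomialSpan := by
  refine le_antisymm (Submodule.span_mono ?_) (Submodule.span_le.mpr ?_)
  · rintro x ⟨μ, -, ν, -, A, hA, rfl⟩
    exact ⟨μ, ν, A, hA, rfl⟩
  · rintro x ⟨μ, ν, A, hA, rfl⟩
    by_cases hμ : μ ∈ G.wordsHash
    · by_cases hν : ν ∈ G.wordsHash
      · exact Submodule.subset_span ⟨μ, hμ, ν, hν, A, hA, rfl⟩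
      · simp [ρ.sWord_eq_zero hacc hν]
    · simp [ρ.sWord_eq_zero hacc hμ]

theorem mul_mem_monomialSpan_of_monomial (ρ : LabeledSpaceRep G ℬ B) {b : B}
    (h : ∀ μ ν : List Λ, ∀ A ∈ ℬ,
      b * (ρ.sWord μ * ρ.p A * star (ρ.sWord ν)) ∈ ρ.monomialSpan)
    {x : B} (hx : x ∈ ρ.monomialSpan) : b * x ∈ ρ.monomialSpan := by
  suffices ρ.monomialSpan ≤ ρ.monomialSpan.comap (LinearMap.mulLeft ℂ b) from this hx
  refine Submodule.span_le.mpr ?_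
  rintro x ⟨μ, ν, A, hA, rfl⟩
  exact h μ ν A hA

theorem p_mul_mem_monomialSpan (ρ : LabeledSpaceRep G ℬ B) (hacc : G.Accommodating ℬ)
    {A : Set V} (hA : A ∈ ℬ) {x : B} (hx : x ∈ ρ.monomialSpan) :
    ρ.p A * x ∈ ρ.monomialSpan := by
  refine ρ.mul_mem_monomialSpan_of_monomial (fun μ ν C hC => ?_) hx
  have hR := hacc.iterRange_mem hA μ
  rw [← mul_assoc, ← mul_assoc, ρ.p_mul_sWord hacc hA, mul_assoc (ρ.sWord μ),
    ρ.p_inter _ hR C hC]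
  exact ρ.monomial_mem μ ν (hacc.inter_mem _ hR C hC)

theorem s_mul_mem_monomialSpan (ρ : LabeledSpaceRep G ℬ B) (a : Λ) {x : B}
    (hx : x ∈ ρ.monomialSpan) : ρ.s a * x ∈ ρ.monomialSpan := by
  refine ρ.mul_mem_monomialSpan_of_monomial (fun μ ν C hC => ?_) hx
  rw [← mul_assoc, ← mul_assoc, ← sWord_cons]
  exact ρ.monomial_mem (a :: μ) ν hC

theorem star_s_mul_mem_monomialSpan (ρ : LabeledSpaceRep G ℬ B) (hacc : G.Accommodating ℬ)
    (a : Λ) {x : B} (hx : x ∈ ρ.monomialSpan) : star (ρ.s a) * x ∈ ρ.monomialSpan := by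
  refine ρ.mul_mem_monomialSpan_of_monomial (fun μ ν C hC => ?_) hx
  cases μ with
  | nil =>
    have h := ρ.monomial_mem [] (ν ++ [a])
      (hacc.relRange_mem C hC [a] (G.singleton_mem_words a))
    rwa [sWord_concat, star_mul, ← mul_assoc, sWord_nil, one_mul, ← ρ.s_star_p a C hC,
      mul_assoc, ← one_mul (ρ.p C), ← sWord_nil ρ] at h
  | cons b μ =>
    rw [sWord_cons, mul_assoc, mul_assoc, ← mul_assoc (star (ρ.s a)), ← mul_assoc (ρ.sWord μ),
      ρ.s_star_s]
    split_ifs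
    · exact ρ.p_mul_mem_monomialSpan hacc (hacc.range_mem [a] (G.singleton_mem_words a))
        (ρ.monomial_mem μ ν hC)
    · simp

theorem sWord_mul_mem_monomialSpan (ρ : LabeledSpaceRep G ℬ B) (μ : List Λ) {x : B}
    (hx : x ∈ ρ.monomialSpan) : ρ.sWord μ * x ∈ ρ.monomialSpan := by
  induction μ with
  | nil => simpa
  | cons a μ ih => simpa only [sWord_cons, mul_assoc] using ρ.s_mul_mem_monomialSpan a ih

theorem star_sWord_mul_mem_monomialSpan (ρ : LabeledSpaceRep G ℬ B)
    (hacc : G.Accommodating ℬ) (μ : List Λ) {x : B} (hx : x ∈ ρ.monomialSpan) :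
    star (ρ.sWord μ) * x ∈ ρ.monomialSpan := by
  induction μ generalizing x with
  | nil => simpa
  | cons a μ ih =>
    simpa only [sWord_cons, star_mul, mul_assoc] using
      ih (ρ.star_s_mul_mem_monomialSpan hacc a hx)

theorem mul_mem_monomialSpan (ρ : LabeledSpaceRep G ℬ B) (hacc : G.Accommodating ℬ)
    {x y : B} (hx : x ∈ ρ.monomialSpan) (hy : y ∈ ρ.monomialSpan) :
    x * y ∈ ρ.monomialSpan := by
  suffices ρ.monomialSpan ≤ ρ.monomialSpan.comap (LinearMap.mulRight ℂ y) from this hx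
  refine Submodule.span_le.mpr ?_
  rintro _ ⟨μ, ν, A, hA, rfl⟩
  change _ * y ∈ ρ.monomialSpan
  rw [mul_assoc, mul_assoc]
  exact ρ.sWord_mul_mem_monomialSpan μ (ρ.p_mul_mem_monomialSpan hacc hA
    (ρ.star_sWord_mul_mem_monomialSpan hacc ν hy))

theorem star_mem_monomialSpan (ρ : LabeledSpaceRep G ℬ B) {x : B}
    (hx : x ∈ ρ.monomialSpan) : star x ∈ ρ.monomialSpan := by
  induction hx using Submodule.span_induction with
  | mem x hx =>
    obtain ⟨μ, ν, A, hA, rfl⟩ := hx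
    rw [star_mul, star_mul, star_star, ρ.p_selfAdjoint A hA, ← mul_assoc]
    exact ρ.monomial_mem ν μ hA
  | zero => simp
  | add x y _ _ hx hy => simpa using add_mem hx hy
  | smul c x _ hx => simpa using Submodule.smul_mem _ (star c) hx

/-- The span of the monomials, as a star-subalgebra. -/
noncomputable def monomialSubalgebra (ρ : LabeledSpaceRep G ℬ B) (hacc : G.Accommodating ℬ) :
    NonUnitalStarSubalgebra ℂ B where
  toSubmodule := ρ.monomialSpan
  mul_mem' := ρ.mul_mem_monomialSpan hacc
  star_mem' := ρ.star_mem_monomialSpan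

theorem sWord_mul_mem (ρ : LabeledSpaceRep G ℬ B) {S : NonUnitalStarSubalgebra ℂ B}
    (hS : ∀ a, ρ.s a ∈ S) (μ : List Λ) {x : B} (hx : x ∈ S) : ρ.sWord μ * x ∈ S := by
  induction μ with
  | nil => simpa
  | cons a μ ih => simpa only [sWord_cons, mul_assoc] using mul_mem (hS a) ih

theorem coe_adjoin_eq_monomialSpan (ρ : LabeledSpaceRep G ℬ B) (hacc : G.Accommodating ℬ) :
    (NonUnitalStarAlgebra.adjoin ℂ ({x | ∃ A ∈ ℬ, x = ρ.p A} ∪ Set.range ρ.s) : Set B) =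
      ρ.monomialSpan := by
  set S := NonUnitalStarAlgebra.adjoin ℂ ({x | ∃ A ∈ ℬ, x = ρ.p A} ∪ Set.range ρ.s)
  have hsub := NonUnitalStarAlgebra.subset_adjoin ℂ
    ({x | ∃ A ∈ ℬ, x = ρ.p A} ∪ Set.range ρ.s)
  have hp : ∀ A ∈ ℬ, ρ.p A ∈ S := fun A hA => hsub (Or.inl ⟨A, hA, rfl⟩)
  have hs : ∀ a, ρ.s a ∈ S := fun a => hsub (Or.inr ⟨a, rfl⟩)
  refine Set.Subset.antisymm ?_ ?_
  · suffices S ≤ ρ.monomialSubalgebra hacc from this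
    refine NonUnitalStarAlgebra.adjoin_le ?_
    rintro _ (⟨A, hA, rfl⟩ | ⟨a, rfl⟩)
    · change ρ.p A ∈ ρ.monomialSpan
      simpa using ρ.monomial_mem [] [] hA
    · have h := ρ.monomial_mem [a] [] (hacc.range_mem [a] (G.singleton_mem_words a))
      rwa [sWord_cons, sWord_nil, mul_one, star_one, mul_one, ρ.s_mul_p_range] at h
  · suffices ρ.monomialSpan ≤ S.toSubmodule from this
    refine Submodule.span_le.mpr ?_
    rintro _ ⟨μ, ν, A, hA, rfl⟩
    have h := star_mem (ρ.sWord_mul_mem hs ν (star_mem (hp A hA)))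
    rw [star_mul, star_star] at h
    rw [mul_assoc]
    exact ρ.sWord_mul_mem hs μ h

end LabeledSpaceRep

theorem stmt8 {V : Type u} {E : Type v} {Λ : Type w}
    (G : LabeledGraph V E Λ) (ℬ : Set (Set V))
    (hacc : G.Accommodating ℬ) (hwlr : G.WeaklyLeftResolving ℬ)
    {B : Type*} [CStarAlgebra B] (ρ : LabeledSpaceRep G ℬ B) :
    closure (↑(NonUnitalStarAlgebra.adjoin ℂ
        ({x | ∃ A ∈ ℬ, x = ρ.p A} ∪ Set.range ρ.s)) : Set B) =
    closure (↑(Submodule.span ℂ {x : B | ∃ μ ∈ G.wordsHash, ∃ ν ∈ G.wordsHash, ∃ A ∈ ℬ,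
        x = ρ.sWord μ * ρ.p A * star (ρ.sWord ν)}) : Set B) := by
  rw [ρ.coe_adjoin_eq_monomialSpan hacc, ρ.span_words_eq_monomialSpan hacc]
end

section
/- Let E be a directed graph with E⁰ finite, let (E, 𝓛, 𝓑) be a normal labeled space with E⁰_sink ∈ 𝓑, and for x ∈ E⁰_sink define A_x := ⋂{A ∈ 𝓑 : x ∈ A}. Then for every x ∈ E⁰_sink: A_x ∈ 𝓑, A_x ⊆ E⁰_sink, and A_x is a minimal sinks set, i.e., A_x is nonempty and for every B ∈ 𝓑 either A_x ⊆ B or A_x ∩ B = ∅. -/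
universe u v w

/-- In a family of subsets of a finite type closed under binary intersections, the intersection of
all members containing a point of some member is again a member. -/
theorem sInter_mem_of_inter_mem {V : Type*} [Finite V] {ℬ : Set (Set V)}
    (h : ∀ A ∈ ℬ, ∀ B ∈ ℬ, A ∩ B ∈ ℬ) {x : V} {C : Set V} (hC : C ∈ ℬ) (hx : x ∈ C) :
    ⋂₀ {A | A ∈ ℬ ∧ x ∈ A} ∈ ℬ :=
  InfClosed.sInf_mem_of_nonempty (fun A hA B hB => h A hA B hB) (Set.toFinite _)
    ⟨C, hC, hx⟩ fun _ hA => hA.1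

theorem stmt17 {V : Type u} {E : Type v} {Λ : Type w} [Finite V]
    (G : LabeledGraph V E Λ) (ℬ : Set (Set V))
    (hacc : G.Accommodating ℬ) (hnd : G.NonDegenerate ℬ)
    (hsinks : G.sinks ∈ ℬ)
    (x : V) (hx : x ∈ G.sinks) :
    ⋂₀ {A | A ∈ ℬ ∧ x ∈ A} ∈ ℬ ∧
    ⋂₀ {A | A ∈ ℬ ∧ x ∈ A} ⊆ G.sinks ∧
    G.MinimalSinksSet ℬ (⋂₀ {A | A ∈ ℬ ∧ x ∈ A}) := by
  have hmem : ⋂₀ {A | A ∈ ℬ ∧ x ∈ A} ∈ ℬ := sInter_mem_of_inter_mem hacc.inter_mem hsinks hx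
  have hxmem : x ∈ ⋂₀ {A | A ∈ ℬ ∧ x ∈ A} := fun _ hA => hA.2
  have hsub : ⋂₀ {A | A ∈ ℬ ∧ x ∈ A} ⊆ G.sinks := Set.sInter_subset_of_mem ⟨hsinks, hx⟩
  refine ⟨hmem, hsub, hmem, ⟨x, hxmem⟩, hsub, fun B hB => ?_⟩
  by_cases hxB : x ∈ B
  · exact Or.inl (Set.sInter_subset_of_mem ⟨hB, hxB⟩)
  · right
    have hdiff := Set.sInter_subset_of_mem
      (show _ ∈ {A | A ∈ ℬ ∧ x ∈ A} from ⟨hnd _ hmem B hB, hxmem, hxB⟩)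
    exact Set.eq_empty_of_forall_notMem fun y hy => (hdiff hy.1).2 hy.2
end

section
/- Let E be a directed graph with E⁰ finite, let (E, 𝓛, 𝓑) be a normal labeled space with E⁰_sink ∈ 𝓑, and for x ∈ E⁰_sink define A_x := ⋂{A ∈ 𝓑 : x ∈ A}. Then for all x, y ∈ E⁰_sink, either A_x = A_y or A_x ∩ A_y = ∅; and for every A ∈ 𝓑, A ∩ E⁰_sink = ⋃_{x ∈ A ∩ E⁰_sink} A_x, so that A ∩ E⁰_sink is a disjoint union of sets from {A_x : x ∈ E⁰_sink}. -/
universe u v w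

/-- In a family of sets closed under differences, the atoms cut out by two points coincide as
soon as one of the points lies in the atom of the other. -/
theorem sInter_mem_eq_of_mem {V : Type*} {ℬ : Set (Set V)}
    (hdiff : ∀ A ∈ ℬ, ∀ B ∈ ℬ, A \ B ∈ ℬ) {S : Set V} (hS : S ∈ ℬ) {x z : V} (hx : x ∈ S)
    (hz : z ∈ ⋂₀ {A | A ∈ ℬ ∧ x ∈ A}) :
    ⋂₀ {A | A ∈ ℬ ∧ z ∈ A} = ⋂₀ {A | A ∈ ℬ ∧ x ∈ A} := by
  congr 1
  ext B
  refine and_congr_right fun hB => ⟨fun hzB => ?_, fun hxB => hz B ⟨hB, hxB⟩⟩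
  by_contra hxB
  exact (hz (S \ B) ⟨hdiff S hS B hB, hx, hxB⟩).2 hzB

theorem stmt18 {V : Type u} {E : Type v} {Λ : Type w} [Finite V]
    (G : LabeledGraph V E Λ) (ℬ : Set (Set V))
    (hacc : G.Accommodating ℬ) (hnd : G.NonDegenerate ℬ)
    (hsinks : G.sinks ∈ ℬ) :
    (∀ x ∈ G.sinks, ∀ y ∈ G.sinks,
      ⋂₀ {A | A ∈ ℬ ∧ x ∈ A} = ⋂₀ {A | A ∈ ℬ ∧ y ∈ A} ∨
      ⋂₀ {A | A ∈ ℬ ∧ x ∈ A} ∩ ⋂₀ {A | A ∈ ℬ ∧ y ∈ A} = ∅) ∧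
    ∀ A ∈ ℬ, A ∩ G.sinks = ⋃ x ∈ A ∩ G.sinks, ⋂₀ {A' | A' ∈ ℬ ∧ x ∈ A'} := by
  refine ⟨fun x hx y hy => ?_, fun A hA => ?_⟩
  · refine or_iff_not_imp_right.mpr fun h => ?_
    obtain ⟨z, hzx, hzy⟩ := Set.nonempty_iff_ne_empty.mpr h
    exact (sInter_mem_eq_of_mem hnd hsinks hx hzx).symm.trans
      (sInter_mem_eq_of_mem hnd hsinks hy hzy)
  · refine Set.Subset.antisymm (fun x hx => Set.mem_biUnion hx fun _ hB => hB.2) ?_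
    exact Set.iUnion₂_subset fun x hx =>
      Set.sInter_subset_of_mem ⟨hacc.inter_mem A hA _ hsinks, hx⟩
end
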